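/- Program 0-substitution: if the program typing Γ, x:A; Δ ⊢ m : B and the logical typing Γ ⊢ n : A are derivable (with x not occurring in Δ), then Γ; Δ ⊢ m[n/x] : B[n/x] is derivable. -/

import Mathlib

namespace TLL

/-- The two sorts of TLL: `U` (non-linear) and `L` (linear). -/
inductive Srt : Type
  | U | L
deriving DecidableEq

/-- TLL terms in de Bruijn representation: variables, sorts, the two Π-type
formers (irrelevant `pi0` and relevant `pi1`), the two λ-formers, application,
the erased constant `box`, and heap pointers `ptr`. -/
inductive Tm : Type
  | var  : Nat → Tm
  | srt  : Srt → Tm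
  | pi0  : Srt → Tm → Tm → Tm
  | pi1  : Srt → Tm → Tm → Tm
  | lam0 : Srt → Tm → Tm → Tm
  | lam1 : Srt → Tm → Tm → Tm
  | app  : Tm → Tm → Tm
  | box  : Tm
  | ptr  : Nat → Tm

def upr (ξ : Nat → Nat) : Nat → Nat
  | 0 => 0
  | n + 1 => ξ n + 1

def rename (ξ : Nat → Nat) : Tm → Tm
  | .var x => .var (ξ x)
  | .srt s => .srt s
  | .pi0 t A B => .pi0 t (rename ξ A) (rename (upr ξ) B)
  | .pi1 t A B => .pi1 t (rename ξ A) (rename (upr ξ) B)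
  | .lam0 t A m => .lam0 t (rename ξ A) (rename (upr ξ) m)
  | .lam1 t A m => .lam1 t (rename ξ A) (rename (upr ξ) m)
  | .app m n => .app (rename ξ m) (rename ξ n)
  | .box => .box
  | .ptr l => .ptr l

def up (σ : Nat → Tm) : Nat → Tm
  | 0 => .var 0
  | n + 1 => rename Nat.succ (σ n)

def subst (σ : Nat → Tm) : Tm → Tm
  | .var x => σ x
  | .srt s => .srt s
  | .pi0 t A B => .pi0 t (subst σ A) (subst (up σ) B)
  | .pi1 t A B => .pi1 t (subst σ A) (subst (up σ) B)
  | .lam0 t A m => .lam0 t (subst σ A) (subst (up σ) m)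
  | .lam1 t A m => .lam1 t (subst σ A) (subst (up σ) m)
  | .app m n => .app (subst σ m) (subst σ n)
  | .box => .box
  | .ptr l => .ptr l

/-- `subst1 n m` is `m[n/x]` for the topmost bound variable `x`. -/
def subst1 (n : Tm) (m : Tm) : Tm :=
  subst (fun i => match i with | 0 => n | i + 1 => .var i) m

/-- Logical one-step reduction `m ~> n`: full β-reduction with both β-rules,
closed under all structural subterm positions. -/
inductive LStep : Tm → Tm → Prop
  | beta0 {t A m n} : LStep (.app (.lam0 t A m) n) (subst1 n m)
  | beta1 {t A m n} : LStep (.app (.lam1 t A m) n) (subst1 n m)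
  | appL {m m' n} : LStep m m' → LStep (.app m n) (.app m' n)
  | appR {m n n'} : LStep n n' → LStep (.app m n) (.app m n')
  | pi0A {t A A' B} : LStep A A' → LStep (.pi0 t A B) (.pi0 t A' B)
  | pi0B {t A B B'} : LStep B B' → LStep (.pi0 t A B) (.pi0 t A B')
  | pi1A {t A A' B} : LStep A A' → LStep (.pi1 t A B) (.pi1 t A' B)
  | pi1B {t A B B'} : LStep B B' → LStep (.pi1 t A B) (.pi1 t A B')
  | lam0A {t A A' m} : LStep A A' → LStep (.lam0 t A m) (.lam0 t A' m)
  | lam0M {t A m m'} : LStep m m' → LStep (.lam0 t A m) (.lam0 t A m')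
  | lam1A {t A A' m} : LStep A A' → LStep (.lam1 t A m) (.lam1 t A' m)
  | lam1M {t A m m'} : LStep m m' → LStep (.lam1 t A m) (.lam1 t A m')

/-- Multi-step logical reduction. -/
abbrev LRed : Tm → Tm → Prop := Relation.ReflTransGen LStep

/-- Definitional equality `A ≃ B`: equivalence closure of logical reduction. -/
def Conv (A B : Tm) : Prop := Relation.EqvGen LStep A B

/-- Parallel logical reduction `m ⇒ n`. -/
inductive PStep : Tm → Tm → Prop
  | var {x} : PStep (.var x) (.var x)
  | srt {s} : PStep (.srt s) (.srt s)
  | box : PStep .box .box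
  | ptr {l} : PStep (.ptr l) (.ptr l)
  | pi0 {t A A' B B'} : PStep A A' → PStep B B' → PStep (.pi0 t A B) (.pi0 t A' B')
  | pi1 {t A A' B B'} : PStep A A' → PStep B B' → PStep (.pi1 t A B) (.pi1 t A' B')
  | lam0 {t A A' m m'} : PStep A A' → PStep m m' → PStep (.lam0 t A m) (.lam0 t A' m')
  | lam1 {t A A' m m'} : PStep A A' → PStep m m' → PStep (.lam1 t A m) (.lam1 t A' m')
  | app {m m' n n'} : PStep m m' → PStep n n' → PStep (.app m n) (.app m' n')
  | beta0 {t A m m' n n'} : PStep m m' → PStep n n' →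
      PStep (.app (.lam0 t A m) n) (subst1 n' m')
  | beta1 {t A m m' n n'} : PStep m m' → PStep n n' →
      PStep (.app (.lam1 t A m) n) (subst1 n' m')

/-- Logical contexts: lists of types (de Bruijn). -/
abbrev Ctx := List Tm

/-- `Has Γ x A`: variable `x` has type `A` in logical context `Γ`
(with the appropriate de Bruijn shifts). -/
inductive Has : Ctx → Nat → Tm → Prop
  | zero {Γ A} : Has (A :: Γ) 0 (rename Nat.succ A)
  | succ {Γ x A B} : Has Γ x A → Has (B :: Γ) (x + 1) (rename Nat.succ A)

mutual
/-- Well-formed logical contexts. -/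
inductive LWf : Ctx → Prop
  | nil : LWf []
  | cons {Γ A s} : LWf Γ → LTyped Γ A (.srt s) → LWf (A :: Γ)

/-- The logical typing judgment `Γ ⊢ m : A`. -/
inductive LTyped : Ctx → Tm → Tm → Prop
  | srt {Γ} (s : Srt) : LWf Γ → LTyped Γ (.srt s) (.srt .U)
  | var {Γ x A} : LWf Γ → Has Γ x A → LTyped Γ (.var x) A
  | pi0 {Γ A B s r} (t : Srt) :
      LTyped Γ A (.srt s) → LTyped (A :: Γ) B (.srt r) →
      LTyped Γ (.pi0 t A B) (.srt t)
  | pi1 {Γ A B s r} (t : Srt) :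
      LTyped Γ A (.srt s) → LTyped (A :: Γ) B (.srt r) →
      LTyped Γ (.pi1 t A B) (.srt t)
  | lam0 {Γ A B m} (t : Srt) :
      LTyped (A :: Γ) m B → LTyped Γ (.lam0 t A m) (.pi0 t A B)
  | lam1 {Γ A B m} (t : Srt) :
      LTyped (A :: Γ) m B → LTyped Γ (.lam1 t A m) (.pi1 t A B)
  | app0 {Γ m n A B t} :
      LTyped Γ m (.pi0 t A B) → LTyped Γ n A → LTyped Γ (.app m n) (subst1 n B)
  | app1 {Γ m n A B t} :
      LTyped Γ m (.pi1 t A B) → LTyped Γ n A → LTyped Γ (.app m n) (subst1 n B)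
  | conv {Γ m A B s} :
      LTyped Γ m A → LTyped Γ B (.srt s) → Conv A B → LTyped Γ m B
end

/-- Program context entries: either absent, or a sort-annotated type. -/
abbrev Entry := Option (Srt × Tm)

/-- Program contexts, positionally aligned with the logical context. -/
abbrev PCtx := List Entry

/-- The context constraint `Δ ▷ s`. -/
inductive Restr : PCtx → Srt → Prop
  | nil {s} : Restr [] s
  | skip {Δ s} : Restr Δ s → Restr ((none : Entry) :: Δ) s
  | u {Δ A} : Restr Δ .U → Restr (some (.U, A) :: Δ) .U
  | l {Δ s A} : Restr Δ .L → Restr (some (s, A) :: Δ) .L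

/-- Context merge `Δ₁ ∪̇ Δ₂ = Δ`: contraction on shared `U` entries,
`L` entries occur on exactly one side. -/
inductive Merge : PCtx → PCtx → PCtx → Prop
  | nil : Merge [] [] []
  | contra {Δ₁ Δ₂ Δ A} : Merge Δ₁ Δ₂ Δ →
      Merge (some (.U, A) :: Δ₁) (some (.U, A) :: Δ₂) (some (.U, A) :: Δ)
  | left {Δ₁ Δ₂ Δ A} : Merge Δ₁ Δ₂ Δ →
      Merge (some (.L, A) :: Δ₁) ((none : Entry) :: Δ₂) (some (.L, A) :: Δ)
  | right {Δ₁ Δ₂ Δ A} : Merge Δ₁ Δ₂ Δ →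
      Merge ((none : Entry) :: Δ₁) (some (.L, A) :: Δ₂) (some (.L, A) :: Δ)
  | skip {Δ₁ Δ₂ Δ} : Merge Δ₁ Δ₂ Δ →
      Merge ((none : Entry) :: Δ₁) ((none : Entry) :: Δ₂) ((none : Entry) :: Δ)

/-- `PHas Δ x s A`: the entry `x :s A` occurs in `Δ` and the rest of `Δ`
satisfies `▷ U` (so no linear entry is discarded). -/
inductive PHas : PCtx → Nat → Srt → Tm → Prop
  | zero {Δ s A} : Restr Δ .U → PHas (some (s, A) :: Δ) 0 s (rename Nat.succ A)
  | succN {Δ x s A} : PHas Δ x s A → PHas ((none : Entry) :: Δ) (x + 1) s (rename Nat.succ A)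
  | succU {Δ x s A B} : PHas Δ x s A → PHas (some (.U, B) :: Δ) (x + 1) s (rename Nat.succ A)

/-- Well-formed pairs of logical and program contexts `Γ ; Δ ⊢`. -/
inductive PWf : Ctx → PCtx → Prop
  | nil : PWf [] []
  | cons {Γ Δ A s} : PWf Γ Δ → LTyped Γ A (.srt s) → PWf (A :: Γ) (some (s, A) :: Δ)
  | consN {Γ Δ A s} : PWf Γ Δ → LTyped Γ A (.srt s) → PWf (A :: Γ) ((none : Entry) :: Δ)

/-- The program typing judgment `Γ ; Δ ⊢ m : A`. -/
inductive PTyped : Ctx → PCtx → Tm → Tm → Prop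
  | var {Γ Δ x s A} : PWf Γ Δ → PHas Δ x s A → PTyped Γ Δ (.var x) A
  | lam0 {Γ Δ A B m} (t : Srt) :
      PTyped (A :: Γ) ((none : Entry) :: Δ) m B → Restr Δ t →
      PTyped Γ Δ (.lam0 t A m) (.pi0 t A B)
  | lam1 {Γ Δ A B m s} (t : Srt) :
      PTyped (A :: Γ) (some (s, A) :: Δ) m B → Restr Δ t →
      PTyped Γ Δ (.lam1 t A m) (.pi1 t A B)
  | app0 {Γ Δ m n A B t} :
      PTyped Γ Δ m (.pi0 t A B) → LTyped Γ n A →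
      PTyped Γ Δ (.app m n) (subst1 n B)
  | app1 {Γ Δ₁ Δ₂ Δ m n A B t} :
      PTyped Γ Δ₁ m (.pi1 t A B) → PTyped Γ Δ₂ n A → Merge Δ₁ Δ₂ Δ →
      PTyped Γ Δ (.app m n) (subst1 n B)
  | conv {Γ Δ m A B s} :
      PTyped Γ Δ m A → LTyped Γ B (.srt s) → Conv A B →
      PTyped Γ Δ m B

/-- Program values. -/
inductive Value : Tm → Prop
  | var {x} : Value (.var x)
  | lam0 {t A m} : Value (.lam0 t A m)
  | lam1 {t A m} : Value (.lam1 t A m)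

/-- Program (call-by-value) one-step reduction `m ~~> n`. -/
inductive CStep : Tm → Tm → Prop
  | appL {m m' n} : CStep m m' → CStep (.app m n) (.app m' n)
  | appR {m n n'} : CStep n n' → CStep (.app m n) (.app m n')
  | beta0 {t A m n} : CStep (.app (.lam0 t A m) n) (subst1 n m)
  | beta1 {t A m v} : Value v → CStep (.app (.lam1 t A m) v) (subst1 v m)

/-- The erasure judgment `Γ ; Δ ⊢ m ~ m' : A`. -/
inductive Erase : Ctx → PCtx → Tm → Tm → Tm → Prop
  | var {Γ Δ x s A} : PWf Γ Δ → PHas Δ x s A → Erase Γ Δ (.var x) (.var x) A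
  | lam0 {Γ Δ A B m m'} (t : Srt) :
      Erase (A :: Γ) ((none : Entry) :: Δ) m m' B → Restr Δ t →
      Erase Γ Δ (.lam0 t A m) (.lam0 t .box m') (.pi0 t A B)
  | lam1 {Γ Δ A B m m' s} (t : Srt) :
      Erase (A :: Γ) (some (s, A) :: Δ) m m' B → Restr Δ t →
      Erase Γ Δ (.lam1 t A m) (.lam1 t .box m') (.pi1 t A B)
  | app0 {Γ Δ m m' n A B t} :
      Erase Γ Δ m m' (.pi0 t A B) → LTyped Γ n A →
      Erase Γ Δ (.app m n) (.app m' .box) (subst1 n B)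
  | app1 {Γ Δ₁ Δ₂ Δ m m' n n' A B t} :
      Erase Γ Δ₁ m m' (.pi1 t A B) → Erase Γ Δ₂ n n' A → Merge Δ₁ Δ₂ Δ →
      Erase Γ Δ (.app m n) (.app m' n') (subst1 n B)
  | conv {Γ Δ m m' A B s} :
      Erase Γ Δ m m' A → LTyped Γ B (.srt s) → Conv A B →
      Erase Γ Δ m m' B

/-- Heaps: finite maps from locations to sort-annotated values. -/
abbrev Heap := Nat → Option (Srt × Tm)

/-- Heap lookup `Lookup H₁ l v H₂`: non-linear cells persist, linear cells
are deallocated. -/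
inductive Lookup : Heap → Nat → Tm → Heap → Prop
  | u {H l v} : H l = some (.U, v) → Lookup H l v H
  | l {H l v} : H l = some (.L, v) → Lookup H l v (Function.update H l none)

/-- Heap merge `H₁ ∪̇ H₂ = H`. -/
def HMerge (H₁ H₂ H : Heap) : Prop := ∀ l,
  (H₁ l = none ∧ H₂ l = none ∧ H l = none) ∨
  (∃ v, H₁ l = some (.U, v) ∧ H₂ l = some (.U, v) ∧ H l = some (.U, v)) ∨
  (∃ v, H₁ l = some (.L, v) ∧ H₂ l = none ∧ H l = some (.L, v)) ∨
  (∃ v, H₁ l = none ∧ H₂ l = some (.L, v) ∧ H l = some (.L, v))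

/-- The heap constraint `H ▷ s`. -/
def HRestr (H : Heap) : Srt → Prop
  | .U => ∀ l s v, H l = some (s, v) → s = Srt.U
  | .L => True

/-- Heap reduction `H ; m ~~> H' ; m'`. -/
inductive HStep : Heap → Tm → Heap → Tm → Prop
  | alloc0 {H l t m} : H l = none →
      HStep H (.lam0 t .box m) (Function.update H l (some (t, .lam0 t .box m))) (.ptr l)
  | alloc1 {H l t m} : H l = none →
      HStep H (.lam1 t .box m) (Function.update H l (some (t, .lam1 t .box m))) (.ptr l)
  | appL {H H' m m' n} : HStep H m H' m' → HStep H (.app m n) H' (.app m' n)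
  | appR {H H' m n n'} : HStep H n H' n' → HStep H (.app m n) H' (.app m n')
  | beta0 {H H' l t m n} : Lookup H l (.lam0 t .box m) H' →
      HStep H (.app (.ptr l) n) H' (subst1 .box m)
  | beta1 {H H' l₁ l₂ t m} : Lookup H l₁ (.lam1 t .box m) H' →
      HStep H (.app (.ptr l₁) (.ptr l₂)) H' (subst1 (.ptr l₂) m)

/-- Pointer resolution `H ; m ~ n`. -/
inductive Resolve : Heap → Tm → Tm → Prop
  | var {H x} : HRestr H .U → Resolve H (.var x) (.var x)
  | lam0 {H t m' m} : HRestr H t → Resolve H m' m →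
      Resolve H (.lam0 t .box m') (.lam0 t .box m)
  | lam1 {H t m' m} : HRestr H t → Resolve H m' m →
      Resolve H (.lam1 t .box m') (.lam1 t .box m)
  | app0 {H m' m} : Resolve H m' m → Resolve H (.app m' .box) (.app m .box)
  | app1 {H₁ H₂ H m' m n' n} : HMerge H₁ H₂ H →
      Resolve H₁ m' m → Resolve H₂ n' n → Resolve H (.app m' n') (.app m n)
  | ptr {H H' l v' v} : Lookup H l v' H' → Resolve H' v' v → Resolve H (.ptr l) v

/-- `ClosedUnder k m`: all free de Bruijn variables of `m` are `< k`. -/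
def ClosedUnder : Nat → Tm → Prop
  | k, .var x => x < k
  | _, .srt _ => True
  | k, .pi0 _ A B => ClosedUnder k A ∧ ClosedUnder (k + 1) B
  | k, .pi1 _ A B => ClosedUnder k A ∧ ClosedUnder (k + 1) B
  | k, .lam0 _ A m => ClosedUnder k A ∧ ClosedUnder (k + 1) m
  | k, .lam1 _ A m => ClosedUnder k A ∧ ClosedUnder (k + 1) m
  | k, .app m n => ClosedUnder k m ∧ ClosedUnder k n
  | _, .box => True
  | _, .ptr _ => True

/-- WR-heaps: heaps plausibly produced by heap reduction. -/
inductive WrHeap : Heap → Prop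
  | nil : WrHeap (fun _ => none)
  | lam0 {H l t m} : ClosedUnder 1 m → WrHeap H → H l = none →
      WrHeap (Function.update H l (some (t, .lam0 t .box m)))
  | lam1 {H l t m} : ClosedUnder 1 m → WrHeap H → H l = none →
      WrHeap (Function.update H l (some (t, .lam1 t .box m)))

/-- Well-resolved `H ⊢ a ~ b ~ c : A`. -/
def WellResolved (H : Heap) (a b c A : Tm) : Prop :=
  Erase [] [] a b A ∧ Resolve H c b

/-! ### Renaming and substitution -/

theorem up_var_comp (ξ : Nat → Nat) : up (fun i => .var (ξ i)) = fun i => .var (upr ξ i) := by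
  funext i; cases i <;> rfl

theorem rename_eq_subst (ξ : Nat → Nat) (m : Tm) :
    rename ξ m = subst (fun i => .var (ξ i)) m := by
  induction m generalizing ξ <;> simp_all [rename, subst, up_var_comp]

theorem up_comp_upr (σ : Nat → Tm) (ξ : Nat → Nat) :
    up (fun i => σ (ξ i)) = fun i => up σ (upr ξ i) := by
  funext i; cases i <;> rfl

theorem subst_rename (σ : Nat → Tm) (ξ : Nat → Nat) (m : Tm) :
    subst σ (rename ξ m) = subst (fun i => σ (ξ i)) m := by
  induction m generalizing σ ξ <;> simp_all [rename, subst, up_comp_upr]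

theorem rename_rename (ξ ζ : Nat → Nat) (m : Tm) :
    rename ξ (rename ζ m) = rename (fun i => ξ (ζ i)) m := by
  rw [rename_eq_subst, subst_rename, ← rename_eq_subst]

theorem up_rename_comp (ξ : Nat → Nat) (σ : Nat → Tm) :
    up (fun i => rename ξ (σ i)) = fun i => rename (upr ξ) (up σ i) := by
  funext i
  cases i with
  | zero => rfl
  | succ i => simp [up, rename_rename, upr]

theorem rename_subst (ξ : Nat → Nat) (σ : Nat → Tm) (m : Tm) :
    rename ξ (subst σ m) = subst (fun i => rename ξ (σ i)) m := by
  induction m generalizing σ ξ <;> simp_all [rename, subst, up_rename_comp]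

theorem subst_up_rename_succ (σ : Nat → Tm) (m : Tm) :
    subst (up σ) (rename Nat.succ m) = rename Nat.succ (subst σ m) := by
  rw [subst_rename, rename_subst]; rfl

theorem up_subst_comp (τ σ : Nat → Tm) :
    up (fun i => subst τ (σ i)) = fun i => subst (up τ) (up σ i) := by
  funext i
  cases i with
  | zero => rfl
  | succ i => simp [up, subst_up_rename_succ]

theorem subst_subst (τ σ : Nat → Tm) (m : Tm) :
    subst τ (subst σ m) = subst (fun i => subst τ (σ i)) m := by
  induction m generalizing σ τ <;> simp_all [subst, up_subst_comp]

theorem up_var : up .var = .var := by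
  funext i; cases i <;> rfl

theorem subst_var (m : Tm) : subst .var m = m := by
  induction m <;> simp_all [subst, up_var]

theorem subst1_rename_succ (n m : Tm) : subst1 n (rename Nat.succ m) = m := by
  rw [subst1, subst_rename]; exact subst_var m

theorem subst_subst1 (σ : Nat → Tm) (n m : Tm) :
    subst σ (subst1 n m) = subst1 (subst σ n) (subst (up σ) m) := by
  rw [subst1, subst1, subst_subst, subst_subst]
  congr 1
  funext i
  cases i with
  | zero => rfl
  | succ i => exact (subst1_rename_succ _ _).symm

theorem LStep.subst {m m' : Tm} (h : LStep m m') (σ : Nat → Tm) :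
    LStep (subst σ m) (subst σ m') := by
  induction h generalizing σ with
  | beta0 => rw [subst_subst1]; exact .beta0
  | beta1 => rw [subst_subst1]; exact .beta1
  | appL _ ih => exact .appL (ih σ)
  | appR _ ih => exact .appR (ih σ)
  | pi0A _ ih => exact .pi0A (ih σ)
  | pi0B _ ih => exact .pi0B (ih (up σ))
  | pi1A _ ih => exact .pi1A (ih σ)
  | pi1B _ ih => exact .pi1B (ih (up σ))
  | lam0A _ ih => exact .lam0A (ih σ)
  | lam0M _ ih => exact .lam0M (ih (up σ))
  | lam1A _ ih => exact .lam1A (ih σ)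
  | lam1M _ ih => exact .lam1M (ih (up σ))

theorem Conv.subst {A B : Tm} (h : Conv A B) (σ : Nat → Tm) :
    Conv (subst σ A) (subst σ B) := by
  induction h with
  | rel _ _ h => exact .rel _ _ (h.subst σ)
  | refl => exact .refl _
  | symm _ _ _ ih => exact .symm _ _ ih
  | trans _ _ _ _ _ ih₁ ih₂ => exact .trans _ _ _ ih₁ ih₂

/-! ### Logical typing -/

/-- Every type in a context is well-sorted and satisfies `P`. -/
def AllTypes (P : Ctx → Tm → Tm → Prop) : Ctx → Prop
  | [] => True
  | A :: Γ => AllTypes P Γ ∧ ∃ s, LTyped Γ A (.srt s) ∧ P Γ A (.srt s)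

/-- Induction on logical typing where the λ-cases also provide the induction hypothesis
for the domain type. -/
theorem LTyped.induction_dom {P : Ctx → Tm → Tm → Prop}
    (srt : ∀ Γ s, LWf Γ → P Γ (.srt s) (.srt .U))
    (var : ∀ Γ x A, LWf Γ → Has Γ x A → P Γ (.var x) A)
    (pi0 : ∀ Γ A B s r t, LTyped Γ A (.srt s) → P Γ A (.srt s) →
      P (A :: Γ) B (.srt r) → P Γ (.pi0 t A B) (.srt t))
    (pi1 : ∀ Γ A B s r t, LTyped Γ A (.srt s) → P Γ A (.srt s) →
      P (A :: Γ) B (.srt r) → P Γ (.pi1 t A B) (.srt t))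
    (lam0 : ∀ Γ A B m s t, LTyped Γ A (.srt s) → P Γ A (.srt s) →
      P (A :: Γ) m B → P Γ (.lam0 t A m) (.pi0 t A B))
    (lam1 : ∀ Γ A B m s t, LTyped Γ A (.srt s) → P Γ A (.srt s) →
      P (A :: Γ) m B → P Γ (.lam1 t A m) (.pi1 t A B))
    (app0 : ∀ Γ m n A B t, P Γ m (.pi0 t A B) → P Γ n A → P Γ (.app m n) (subst1 n B))
    (app1 : ∀ Γ m n A B t, P Γ m (.pi1 t A B) → P Γ n A → P Γ (.app m n) (subst1 n B))
    (conv : ∀ Γ m A B s, P Γ m A → P Γ B (.srt s) → Conv A B → P Γ m B)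
    {Γ : Ctx} {m A : Tm} (h : LTyped Γ m A) : P Γ m A := by
  refine (LTyped.rec (motive_1 := fun Γ _ => AllTypes P Γ)
    (motive_2 := fun Γ m A _ => AllTypes P Γ ∧ P Γ m A)
    ?_ ?_ ?_ ?_ ?_ ?_ ?_ ?_ ?_ ?_ ?_ h).2
  · trivial
  · intro Γ A s _ hA ihΓ ihA
    exact ⟨ihΓ, s, hA, ihA.2⟩
  · intro Γ s hΓ ih
    exact ⟨ih, srt _ _ hΓ⟩
  · intro Γ x A hΓ hx ih
    exact ⟨ih, var _ _ _ hΓ hx⟩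
  · intro Γ A B s r t hA _ ihA ihB
    exact ⟨ihA.1, pi0 _ _ _ _ _ _ hA ihA.2 ihB.2⟩
  · intro Γ A B s r t hA _ ihA ihB
    exact ⟨ihA.1, pi1 _ _ _ _ _ _ hA ihA.2 ihB.2⟩
  · rintro Γ A B m t _ ⟨⟨hΓ, s, hA, ihA⟩, ih⟩
    exact ⟨hΓ, lam0 _ _ _ _ _ _ hA ihA ih⟩
  · rintro Γ A B m t _ ⟨⟨hΓ, s, hA, ihA⟩, ih⟩
    exact ⟨hΓ, lam1 _ _ _ _ _ _ hA ihA ih⟩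
  · intro Γ m n A B t _ _ ihm ihn
    exact ⟨ihm.1, app0 _ _ _ _ _ _ ihm.2 ihn.2⟩
  · intro Γ m n A B t _ _ ihm ihn
    exact ⟨ihm.1, app1 _ _ _ _ _ _ ihm.2 ihn.2⟩
  · intro Γ m A B s _ _ hAB ihm ihB
    exact ⟨ihm.1, conv _ _ _ _ _ ihm.2 ihB.2 hAB⟩

/-- `σ` maps the variables of `Γ` to terms of the corresponding types over `Γ'`. -/
def LSub (Γ' : Ctx) (σ : Nat → Tm) (Γ : Ctx) : Prop :=
  ∀ x A, Has Γ x A → LTyped Γ' (σ x) (subst σ A)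

/-- `ξ` maps the variables of `Γ` to variables of the corresponding types over `Γ'`. -/
def LRen (Γ' : Ctx) (ξ : Nat → Nat) (Γ : Ctx) : Prop :=
  ∀ x A, Has Γ x A → Has Γ' (ξ x) (rename ξ A)

theorem rename_upr_succ (ξ : Nat → Nat) (A : Tm) :
    rename (upr ξ) (rename Nat.succ A) = rename Nat.succ (rename ξ A) := by
  rw [rename_rename, rename_rename]; rfl

theorem LRen.upr {Γ Γ' : Ctx} {ξ : Nat → Nat} (h : LRen Γ' ξ Γ) (A : Tm) :
    LRen (rename ξ A :: Γ') (upr ξ) (A :: Γ) := by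
  intro x B hx
  cases hx with
  | zero => rw [rename_upr_succ]; exact .zero
  | succ hx => rw [rename_upr_succ]; exact .succ (h _ _ hx)

theorem rename_subst1 (ξ : Nat → Nat) (n m : Tm) :
    rename ξ (subst1 n m) = subst1 (rename ξ n) (rename (upr ξ) m) := by
  simp only [rename_eq_subst, subst_subst1, up_var_comp]

theorem Conv.rename {A B : Tm} (h : Conv A B) (ξ : Nat → Nat) :
    Conv (rename ξ A) (rename ξ B) := by
  simpa only [rename_eq_subst] using h.subst _

theorem LTyped.rename {Γ : Ctx} {m A : Tm} (h : LTyped Γ m A) {Γ' : Ctx} {ξ : Nat → Nat}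
    (hΓ' : LWf Γ') (hξ : LRen Γ' ξ Γ) : LTyped Γ' (rename ξ m) (rename ξ A) := by
  refine h.induction_dom (P := fun Γ m A => ∀ ⦃Γ' : Ctx⦄ ⦃ξ : Nat → Nat⦄, LWf Γ' → LRen Γ' ξ Γ →
    LTyped Γ' (TLL.rename ξ m) (TLL.rename ξ A))
    ?srt ?var ?pi0 ?pi1 ?lam0 ?lam1 ?app0 ?app1 ?conv hΓ' hξ
  case srt =>
    intro Γ s _ Γ' ξ hΓ' _
    exact .srt s hΓ'
  case var =>
    intro Γ x A _ hx Γ' ξ hΓ' hξ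
    exact .var hΓ' (hξ _ _ hx)
  case pi0 =>
    intro Γ A B s r t _ ihA ihB Γ' ξ hΓ' hξ
    exact .pi0 t (ihA hΓ' hξ) (ihB (.cons hΓ' (ihA hΓ' hξ)) (hξ.upr A))
  case pi1 =>
    intro Γ A B s r t _ ihA ihB Γ' ξ hΓ' hξ
    exact .pi1 t (ihA hΓ' hξ) (ihB (.cons hΓ' (ihA hΓ' hξ)) (hξ.upr A))
  case lam0 =>
    intro Γ A B m s t _ ihA ihm Γ' ξ hΓ' hξ
    exact .lam0 t (ihm (.cons hΓ' (ihA hΓ' hξ)) (hξ.upr A))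
  case lam1 =>
    intro Γ A B m s t _ ihA ihm Γ' ξ hΓ' hξ
    exact .lam1 t (ihm (.cons hΓ' (ihA hΓ' hξ)) (hξ.upr A))
  case app0 =>
    intro Γ m n A B t ihm ihn Γ' ξ hΓ' hξ
    rw [rename_subst1]
    exact .app0 (ihm hΓ' hξ) (ihn hΓ' hξ)
  case app1 =>
    intro Γ m n A B t ihm ihn Γ' ξ hΓ' hξ
    rw [rename_subst1]
    exact .app1 (ihm hΓ' hξ) (ihn hΓ' hξ)
  case conv =>
    intro Γ m A B s ihm ihB hAB Γ' ξ hΓ' hξ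
    exact .conv (ihm hΓ' hξ) (ihB hΓ' hξ) (hAB.rename ξ)

theorem LSub.up {Γ Γ' : Ctx} {σ : Nat → Tm} (h : LSub Γ' σ Γ) {A : Tm}
    (hA : LWf (subst σ A :: Γ')) : LSub (subst σ A :: Γ') (up σ) (A :: Γ) := by
  intro x B hx
  cases hx with
  | zero => rw [subst_up_rename_succ]; exact .var hA .zero
  | succ hx => rw [subst_up_rename_succ]; exact (h _ _ hx).rename hA fun _ _ => .succ

theorem LTyped.subst {Γ : Ctx} {m A : Tm} (h : LTyped Γ m A) {Γ' : Ctx} {σ : Nat → Tm}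
    (hΓ' : LWf Γ') (hσ : LSub Γ' σ Γ) : LTyped Γ' (subst σ m) (subst σ A) := by
  refine h.induction_dom (P := fun Γ m A => ∀ ⦃Γ' : Ctx⦄ ⦃σ : Nat → Tm⦄, LWf Γ' → LSub Γ' σ Γ →
    LTyped Γ' (TLL.subst σ m) (TLL.subst σ A))
    ?srt ?var ?pi0 ?pi1 ?lam0 ?lam1 ?app0 ?app1 ?conv hΓ' hσ
  case srt =>
    intro Γ s _ Γ' σ hΓ' _
    exact .srt s hΓ'
  case var =>
    intro Γ x A _ hx Γ' σ hΓ' hσ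
    exact hσ _ _ hx
  case pi0 =>
    intro Γ A B s r t _ ihA ihB Γ' σ hΓ' hσ
    have hA := LWf.cons hΓ' (ihA hΓ' hσ)
    exact .pi0 t (ihA hΓ' hσ) (ihB hA (hσ.up hA))
  case pi1 =>
    intro Γ A B s r t _ ihA ihB Γ' σ hΓ' hσ
    have hA := LWf.cons hΓ' (ihA hΓ' hσ)
    exact .pi1 t (ihA hΓ' hσ) (ihB hA (hσ.up hA))
  case lam0 =>
    intro Γ A B m s t _ ihA ihm Γ' σ hΓ' hσ
    have hA := LWf.cons hΓ' (ihA hΓ' hσ)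
    exact .lam0 t (ihm hA (hσ.up hA))
  case lam1 =>
    intro Γ A B m s t _ ihA ihm Γ' σ hΓ' hσ
    have hA := LWf.cons hΓ' (ihA hΓ' hσ)
    exact .lam1 t (ihm hA (hσ.up hA))
  case app0 =>
    intro Γ m n A B t ihm ihn Γ' σ hΓ' hσ
    rw [subst_subst1]
    exact .app0 (ihm hΓ' hσ) (ihn hΓ' hσ)
  case app1 =>
    intro Γ m n A B t ihm ihn Γ' σ hΓ' hσ
    rw [subst_subst1]
    exact .app1 (ihm hΓ' hσ) (ihn hΓ' hσ)
  case conv =>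
    intro Γ m A B s ihm ihB hAB Γ' σ hΓ' hσ
    exact .conv (ihm hΓ' hσ) (ihB hΓ' hσ) (hAB.subst σ)

theorem LSub.single {Γ : Ctx} {n A : Tm} (hΓ : LWf Γ) (hn : LTyped Γ n A) :
    LSub Γ (fun i => match i with | 0 => n | i + 1 => .var i) (A :: Γ) := by
  intro x B hx
  cases hx with
  | zero =>
    change LTyped Γ n (subst1 n _)
    rwa [subst1_rename_succ]
  | @succ _ x _ _ hx =>
    change LTyped Γ (.var x) (subst1 n _)
    rw [subst1_rename_succ]
    exact .var hΓ hx

/-! ### Program typing -/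

theorem PWf.lwf {Γ : Ctx} {Δ : PCtx} (h : PWf Γ Δ) : LWf Γ := by
  induction h with
  | nil => exact .nil
  | cons _ hA ih => exact .cons ih hA
  | consN _ hA ih => exact .cons ih hA

theorem Merge.pwf {Δ₁ Δ₂ Δ : PCtx} (h : Merge Δ₁ Δ₂ Δ) {Γ : Ctx}
    (h₁ : PWf Γ Δ₁) (h₂ : PWf Γ Δ₂) : PWf Γ Δ := by
  induction h generalizing Γ with
  | nil => exact h₁
  | contra _ ih =>
    cases h₁ with | cons h₁ hA => cases h₂ with | cons h₂ _ => exact .cons (ih h₁ h₂) hA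
  | left _ ih =>
    cases h₁ with | cons h₁ hA => cases h₂ with | consN h₂ _ => exact .cons (ih h₁ h₂) hA
  | right _ ih =>
    cases h₁ with | consN h₁ _ => cases h₂ with | cons h₂ hA => exact .cons (ih h₁ h₂) hA
  | skip _ ih =>
    cases h₁ with | consN h₁ hA => cases h₂ with | consN h₂ _ => exact .consN (ih h₁ h₂) hA

theorem PTyped.pwf {Γ : Ctx} {Δ : PCtx} {m A : Tm} (h : PTyped Γ Δ m A) : PWf Γ Δ := by
  induction h with
  | var hΓ _ => exact hΓ
  | lam0 _ _ _ ih => cases ih with | consN h _ => exact h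
  | lam1 _ _ _ ih => cases ih with | cons h _ => exact h
  | app0 _ _ ih => exact ih
  | app1 _ _ hΔ ihm ihn => exact hΔ.pwf ihm ihn
  | conv _ _ _ ih => exact ih

/-- `ZSub Γ' Δ' σ Γ Δ`: `σ` instantiates one irrelevant variable of `Γ ; Δ`, below any
number of further binders, yielding `Γ' ; Δ'`. -/
inductive ZSub : Ctx → PCtx → (Nat → Tm) → Ctx → PCtx → Prop
  | single {Γ Δ n A} : LTyped Γ n A →
      ZSub Γ Δ (fun i => match i with | 0 => n | i + 1 => .var i) (A :: Γ) ((none : Entry) :: Δ)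
  | up {Γ' Δ' σ Γ Δ} (s : Srt) (A : Tm) : ZSub Γ' Δ' σ Γ Δ →
      ZSub (subst σ A :: Γ') (some (s, subst σ A) :: Δ') (up σ) (A :: Γ) (some (s, A) :: Δ)
  | upN {Γ' Δ' σ Γ Δ} (A : Tm) : ZSub Γ' Δ' σ Γ Δ →
      ZSub (subst σ A :: Γ') ((none : Entry) :: Δ') (up σ) (A :: Γ) ((none : Entry) :: Δ)

namespace ZSub

variable {Γ Γ' : Ctx} {Δ Δ' : PCtx} {σ : Nat → Tm}

theorem pwf_lsub (h : ZSub Γ' Δ' σ Γ Δ) (hΓ : PWf Γ Δ) : PWf Γ' Δ' ∧ LSub Γ' σ Γ := by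
  induction h with
  | single hn =>
    cases hΓ with | consN hΓ _ => exact ⟨hΓ, .single hΓ.lwf hn⟩
  | up s A _ ih =>
    cases hΓ with
    | cons hΓ hA =>
      obtain ⟨hΓ', hσ⟩ := ih hΓ
      have hA' := hA.subst hΓ'.lwf hσ
      exact ⟨.cons hΓ' hA', hσ.up (.cons hΓ'.lwf hA')⟩
  | upN A _ ih =>
    cases hΓ with
    | consN hΓ hA =>
      obtain ⟨hΓ', hσ⟩ := ih hΓ
      have hA' := hA.subst hΓ'.lwf hσ
      exact ⟨.consN hΓ' hA', hσ.up (.cons hΓ'.lwf hA')⟩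

theorem restr (h : ZSub Γ' Δ' σ Γ Δ) {t : Srt} (ht : Restr Δ t) : Restr Δ' t := by
  induction h with
  | single _ => cases ht with | skip ht => exact ht
  | up s A _ ih =>
    cases ht with
    | u ht => exact .u (ih ht)
    | l ht => exact .l (ih ht)
  | upN A _ ih => cases ht with | skip ht => exact .skip (ih ht)

theorem phas (h : ZSub Γ' Δ' σ Γ Δ) {x : Nat} {s : Srt} {A : Tm} (hx : PHas Δ x s A) :
    ∃ y, σ x = .var y ∧ PHas Δ' y s (subst σ A) := by
  induction h generalizing x A with
  | @single _ _ n _ _ =>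
    cases hx with
    | @succN _ x _ A hx =>
      refine ⟨x, rfl, ?_⟩
      change PHas _ x s (subst1 n _)
      rwa [subst1_rename_succ]
  | up _ _ hσ ih =>
    cases hx with
    | zero hΔ => rw [subst_up_rename_succ]; exact ⟨0, rfl, .zero (hσ.restr hΔ)⟩
    | succU hx =>
      obtain ⟨y, hy, hyA⟩ := ih hx
      rw [subst_up_rename_succ]
      exact ⟨y + 1, by simp [TLL.up, hy, rename], .succU hyA⟩
  | upN _ _ ih =>
    cases hx with
    | succN hx =>
      obtain ⟨y, hy, hyA⟩ := ih hx
      rw [subst_up_rename_succ]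
      exact ⟨y + 1, by simp [TLL.up, hy, rename], .succN hyA⟩

end ZSub

theorem ZSub.merge {Γ Γ' : Ctx} {Δ Δ' Δ₁ Δ₂ : PCtx} {σ : Nat → Tm}
    (h : ZSub Γ' Δ' σ Γ Δ) (hΔ : Merge Δ₁ Δ₂ Δ) :
    ∃ Δ₁' Δ₂', ZSub Γ' Δ₁' σ Γ Δ₁ ∧ ZSub Γ' Δ₂' σ Γ Δ₂ ∧ Merge Δ₁' Δ₂' Δ' := by
  induction h generalizing Δ₁ Δ₂ with
  | single hn =>
    cases hΔ with | skip hΔ => exact ⟨_, _, .single hn, .single hn, hΔ⟩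
  | up s A _ ih =>
    cases hΔ with
    | contra hΔ =>
      obtain ⟨_, _, h₁, h₂, hΔ'⟩ := ih hΔ
      exact ⟨_, _, .up _ A h₁, .up _ A h₂, .contra hΔ'⟩
    | left hΔ =>
      obtain ⟨_, _, h₁, h₂, hΔ'⟩ := ih hΔ
      exact ⟨_, _, .up _ A h₁, .upN A h₂, .left hΔ'⟩
    | right hΔ =>
      obtain ⟨_, _, h₁, h₂, hΔ'⟩ := ih hΔ
      exact ⟨_, _, .upN A h₁, .up _ A h₂, .right hΔ'⟩
  | upN A _ ih =>
    cases hΔ with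
    | skip hΔ =>
      obtain ⟨_, _, h₁, h₂, hΔ'⟩ := ih hΔ
      exact ⟨_, _, .upN A h₁, .upN A h₂, .skip hΔ'⟩

theorem PTyped.zsubst {Γ Γ' : Ctx} {Δ Δ' : PCtx} {σ : Nat → Tm} {m B : Tm}
    (h : PTyped Γ Δ m B) (hσ : ZSub Γ' Δ' σ Γ Δ) :
    PTyped Γ' Δ' (subst σ m) (subst σ B) := by
  induction h generalizing Γ' Δ' σ with
  | var hΓ hx =>
    obtain ⟨y, hy, hyA⟩ := hσ.phas hx
    rw [subst, hy]
    exact .var (hσ.pwf_lsub hΓ).1 hyA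
  | lam0 t _ ht ih => exact .lam0 t (ih (.upN _ hσ)) (hσ.restr ht)
  | lam1 t _ ht ih => exact .lam1 t (ih (.up _ _ hσ)) (hσ.restr ht)
  | app0 hm hn ih =>
    obtain ⟨hΓ', hσ'⟩ := hσ.pwf_lsub hm.pwf
    rw [subst_subst1]
    exact .app0 (ih hσ) (hn.subst hΓ'.lwf hσ')
  | app1 _ _ hΔ ihm ihn =>
    obtain ⟨_, _, h₁, h₂, hΔ'⟩ := hσ.merge hΔ
    rw [subst_subst1]
    exact .app1 (ihm h₁) (ihn h₂) hΔ'
  | conv hm hB hAB ih =>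
    obtain ⟨hΓ', hσ'⟩ := hσ.pwf_lsub hm.pwf
    exact .conv (ih hσ) (hB.subst hΓ'.lwf hσ') (hAB.subst σ)

/-- Program 0-substitution. -/
theorem program_zero_substitution {Γ : Ctx} {Δ : PCtx} {m n A B : Tm}
    (h₁ : PTyped (A :: Γ) ((none : Entry) :: Δ) m B) (h₂ : LTyped Γ n A) :
    PTyped Γ Δ (subst1 n m) (subst1 n B) := by
  exact h₁.zsubst (.single h₂)
end TLL
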